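/- Let K be a field, L/K a field extension, V ⊆ Mat_{m,n}(K) a K-subspace, and d = dim_{K(x)} span{C·x : C ∈ V}. If #L > d, then for each index k ≤ n there exists v ∈ L^n with v_k = 1 such that dim_L span{C·v : C ∈ V} = d. -/

import Mathlib

open MvPolynomial in
/-- A minor of the matrix whose columns are the vectors `C j · x`, with `x` the vector of
indeterminates. -/
noncomputable def genericMinor {m n r : ℕ} {K : Type*} [Field K]
    (C : Fin r → Matrix (Fin m) (Fin n) K) (row : Fin r → Fin m) : MvPolynomial (Fin n) K :=
  (Matrix.of fun i j => ∑ l, MvPolynomial.C (C j (row i) l) * X l).det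

theorem genericMinor_isHomogeneous {m n r : ℕ} {K : Type*} [Field K]
    (C : Fin r → Matrix (Fin m) (Fin n) K) (row : Fin r → Fin m) :
    (genericMinor C row).IsHomogeneous r := by
  rw [genericMinor, Matrix.det_apply]
  refine MvPolynomial.IsHomogeneous.sum _ _ _ fun σ _ => ?_
  have h : (∏ i, (Matrix.of fun i j => ∑ l, MvPolynomial.C (C j (row i) l) *
      (MvPolynomial.X l : MvPolynomial (Fin n) K)) (σ i) i).IsHomogeneous r := by
    have := MvPolynomial.IsHomogeneous.prod Finset.univ
      (fun i : Fin r => (Matrix.of fun i j => ∑ l, MvPolynomial.C (C j (row i) l) *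
        (MvPolynomial.X l : MvPolynomial (Fin n) K)) (σ i) i) (fun _ => 1)
      (fun i _ => by
        rw [Matrix.of_apply]
        exact MvPolynomial.IsHomogeneous.sum _ _ _ fun l _ =>
          MvPolynomial.isHomogeneous_C_mul_X _ _)
    simpa using this
  rcases Int.units_eq_one_or (Equiv.Perm.sign σ) with hs | hs
  · simpa [hs] using h
  · simpa [hs] using h.neg

theorem aeval_genericMinor {m n r : ℕ} {K E : Type*} [Field K] [Field E] [Algebra K E]
    (C : Fin r → Matrix (Fin m) (Fin n) K) (row : Fin r → Fin m) (z : Fin n → E) :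
    MvPolynomial.aeval z (genericMinor C row) =
      (Matrix.of fun i j => ((C j).map (algebraMap K E)).mulVec z (row i)).det := by
  rw [genericMinor, AlgHom.map_det]
  congr 1
  ext i j
  simp [Matrix.mulVec, dotProduct]

/-- Linearly independent vectors have a nonvanishing maximal minor. -/
theorem LinearIndependent.exists_minor_ne_zero {m r : ℕ} {E : Type*} [Field E]
    {f : Fin r → Fin m → E} (hf : LinearIndependent E f) :
    ∃ row : Fin r → Fin m, (Matrix.of fun i j => f j (row i)).det ≠ 0 := by
  have hr : Module.finrank E (Submodule.span E (Set.range (Matrix.of f).col)) = r := by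
    rw [← Matrix.rank_eq_finrank_span_cols]
    simpa using LinearIndependent.rank_matrix (M := Matrix.of f) hf
  obtain ⟨g, hg, hli⟩ : ∃ g : Fin r → Fin r → E,
      (∀ i, g i ∈ Set.range (Matrix.of f).col) ∧ LinearIndependent E g := by
    obtain ⟨g, hg, -, hli⟩ :=
      Submodule.exists_fun_fin_finrank_span_eq E (Set.range (Matrix.of f).col)
    exact ⟨g ∘ Fin.cast hr.symm, fun i => hg _, hli.comp _ (Fin.cast_injective _)⟩
  choose row hrow using hg
  refine ⟨row, ?_⟩
  have : (Matrix.of fun i j => f j (row i)).row = g := by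
    ext i j
    rw [← hrow i]; rfl
  rw [← this, Matrix.linearIndependent_rows_iff_isUnit, Matrix.isUnit_iff_isUnit_det] at hli
  exact hli.ne_zero

theorem linearIndependent_of_minor_ne_zero {m r : ℕ} {E : Type*} [Field E]
    {f : Fin r → Fin m → E} {row : Fin r → Fin m}
    (h : (Matrix.of fun i j => f j (row i)).det ≠ 0) : LinearIndependent E f := by
  have hli : LinearIndependent E (Matrix.of fun i j => f j (row i)).col := by
    rw [Matrix.linearIndependent_cols_iff_isUnit, Matrix.isUnit_iff_isUnit_det]
    exact h.isUnit
  exact LinearIndependent.of_comp (LinearMap.funLeft E E row) hli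

theorem exists_aeval_genericMinor_ne_zero {m n : ℕ} {K E : Type*} [Field K] [Field E]
    [Algebra K E] (V : Submodule K (Matrix (Fin m) (Fin n) K)) (z : Fin n → E) {r : ℕ}
    (hr : Module.finrank E (Submodule.span E
      {w : Fin m → E | ∃ C ∈ V, w = (C.map (algebraMap K E)).mulVec z}) = r) :
    ∃ (C : Fin r → Matrix (Fin m) (Fin n) K) (row : Fin r → Fin m), (∀ j, C j ∈ V) ∧
      MvPolynomial.aeval z (genericMinor C row) ≠ 0 := by
  subst hr
  obtain ⟨f, hf, -, hli⟩ := Submodule.exists_fun_fin_finrank_span_eq E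
    {w : Fin m → E | ∃ C ∈ V, w = (C.map (algebraMap K E)).mulVec z}
  choose C hC hfC using hf
  obtain ⟨row, hrow⟩ := hli.exists_minor_ne_zero
  refine ⟨C, row, hC, ?_⟩
  rw [aeval_genericMinor]
  simpa only [← hfC] using hrow

theorem le_finrank_of_aeval_genericMinor_ne_zero {m n r : ℕ} {K E : Type*} [Field K] [Field E]
    [Algebra K E] {V : Submodule K (Matrix (Fin m) (Fin n) K)} {z : Fin n → E}
    {C : Fin r → Matrix (Fin m) (Fin n) K} {row : Fin r → Fin m} (hC : ∀ j, C j ∈ V)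
    (h : MvPolynomial.aeval z (genericMinor C row) ≠ 0) :
    r ≤ Module.finrank E (Submodule.span E
      {w : Fin m → E | ∃ C ∈ V, w = (C.map (algebraMap K E)).mulVec z}) := by
  rw [aeval_genericMinor] at h
  have hli := linearIndependent_of_minor_ne_zero
    (f := fun j => ((C j).map (algebraMap K E)).mulVec z) h
  calc r = Module.finrank E (Submodule.span E
        (Set.range fun j => ((C j).map (algebraMap K E)).mulVec z)) := by
        rw [finrank_span_eq_card hli, Fintype.card_fin]
    _ ≤ _ := Submodule.finrank_mono <| Submodule.span_mono <| by
        rintro _ ⟨j, rfl⟩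
        exact ⟨C j, hC j, rfl⟩

theorem exists_specialization_of_card_gt {m n : ℕ} {K L : Type*} [Field K] [Field L]
    [Algebra K L]
    (V : Submodule K (Matrix (Fin m) (Fin n) K)) (d : ℕ)
    (hd : d = Module.finrank (FractionRing (MvPolynomial (Fin n) K))
      (Submodule.span (FractionRing (MvPolynomial (Fin n) K))
        {w : Fin m → FractionRing (MvPolynomial (Fin n) K) | ∃ C ∈ V,
          w = (C.map (algebraMap K (FractionRing (MvPolynomial (Fin n) K)))).mulVec
            (fun i => algebraMap (MvPolynomial (Fin n) K)
              (FractionRing (MvPolynomial (Fin n) K)) (MvPolynomial.X i))}))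
    (hL : (d : Cardinal) < Cardinal.mk L) :
    ∀ k : Fin n, ∃ v : Fin n → L, v k = 1 ∧
      Module.finrank L (Submodule.span L
        {w : Fin m → L | ∃ C ∈ V, w = (C.map (algebraMap K L)).mulVec v}) = d := by
  intro k
  set F := FractionRing (MvPolynomial (Fin n) K)
  have aeval_eq (p : MvPolynomial (Fin n) K) :
      MvPolynomial.aeval (fun i => algebraMap (MvPolynomial (Fin n) K) F (MvPolynomial.X i)) p =
        algebraMap (MvPolynomial (Fin n) K) F p := by
    simpa only [MvPolynomial.aeval_X_left_apply, Function.comp_def] using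
      MvPolynomial.aeval_algebraMap_apply F (MvPolynomial.X : Fin n → MvPolynomial (Fin n) K) p
  obtain ⟨C, row, hC, hne⟩ := exists_aeval_genericMinor_ne_zero V _ hd.symm
  have hP : genericMinor C row ≠ 0 := by
    rintro h
    simp [h] at hne
  obtain ⟨z, hz⟩ : ∃ z : Fin n → L,
      MvPolynomial.aeval z (genericMinor C row * MvPolynomial.X k) ≠ 0 := by
    by_contra! h
    have hQ : (MvPolynomial.map (algebraMap K L)
        (genericMinor C row * MvPolynomial.X k)).IsHomogeneous (d + 1) :=
      ((genericMinor_isHomogeneous C row).mul (MvPolynomial.isHomogeneous_X K k)).map _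
    have h0 := hQ.eq_zero_of_forall_eval_eq_zero_of_le_card
      (fun z => by rw [MvPolynomial.eval_map, ← MvPolynomial.aeval_def]; exact h z)
      (by
        rw [Nat.cast_succ, ← Cardinal.succ_natCast]
        exact Order.succ_le_of_lt hL)
    exact mul_ne_zero hP (MvPolynomial.X_ne_zero k) <|
      MvPolynomial.map_injective _ (algebraMap K L).injective (h0.trans (map_zero _).symm)
  rw [map_mul, MvPolynomial.aeval_X] at hz
  have hzk : z k ≠ 0 := right_ne_zero_of_mul hz
  refine ⟨(z k)⁻¹ • z, by simp [hzk], le_antisymm ?_ ?_⟩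
  · obtain ⟨C', row', hC', hne'⟩ := exists_aeval_genericMinor_ne_zero V ((z k)⁻¹ • z) rfl
    rw [hd]
    refine le_finrank_of_aeval_genericMinor_ne_zero (row := row') hC' ?_
    rw [aeval_eq]
    intro h
    rw [(FaithfulSMul.algebraMap_injective _ F).eq_iff' (map_zero _)] at h
    exact hne' (by rw [h, map_zero])
  · refine le_finrank_of_aeval_genericMinor_ne_zero (row := row) hC ?_
    have : (Matrix.of fun i j => ((C j).map (algebraMap K L)).mulVec ((z k)⁻¹ • z) (row i)) =
        (z k)⁻¹ • (Matrix.of fun i j => ((C j).map (algebraMap K L)).mulVec z (row i)) := by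
      ext i j
      simp [Matrix.mulVec_smul]
    rw [aeval_genericMinor, this, Matrix.det_smul, ← aeval_genericMinor]
    exact mul_ne_zero (pow_ne_zero _ (inv_ne_zero hzk)) (left_ne_zero_of_mul hz)
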